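/- arXiv:1305.2141 — 5 statements merged into one kernel-verified Lean document; each statement's English description precedes it below -/
import Mathlib

section
/- For all positive integers n and m with 3 ≤ m ≤ n: if 2 divides both n and m, or if (2m−2) divides n and m−1 is not a power of 2, then ρ^(Z_n, m, 2) ≤ min{ρ(Z_n, m, 2), 2m − 4}; otherwise ρ^(Z_n, m, 2) ≤ min{ρ(Z_n, m, 2), 2m − 3}. -/
open Finset

/-- The `h`-fold sumset of `A`: all sums of `h` not-necessarily-distinct elements of `A`. -/
def hFoldSum {G : Type*} [AddCommMonoid G] [DecidableEq G] (h : ℕ) (A : Finset G) : Finset G :=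
  (Fintype.piFinset fun _ : Fin h => A).image fun f => ∑ i, f i

/-- The `h`-fold restricted sumset of `A`: all sums of `h` pairwise distinct elements of `A`. -/
def hFoldRSum {G : Type*} [AddCommMonoid G] [DecidableEq G] (h : ℕ) (A : Finset G) : Finset G :=
  (A.powersetCard h).image fun s => ∑ x ∈ s, x

/-- `ρ(G,m,h)`: minimum size of the `h`-fold sumset over `m`-element subsets of `G`. -/
noncomputable def rho (G : Type*) [AddCommMonoid G] [DecidableEq G] (m h : ℕ) : ℕ :=
  sInf { k | ∃ A : Finset G, A.card = m ∧ (hFoldSum h A).card = k }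

/-- `ρ^(G,m,h)`: minimum size of the `h`-fold restricted sumset over `m`-element subsets. -/
noncomputable def rhoHat (G : Type*) [AddCommMonoid G] [DecidableEq G] (m h : ℕ) : ℕ :=
  sInf { k | ∃ A : Finset G, A.card = m ∧ (hFoldRSum h A).card = k }

/-- `f_d = (h⌈m/d⌉ - h + 1) d`. -/
def fd (m h d : ℕ) : ℕ := (h * ((m + d - 1) / d) - h + 1) * d

/-- `u(n,m,h) = min { f_d : d ∣ n, d > 0 }`. -/
noncomputable def uFun (n m h : ℕ) : ℕ := sInf { k | ∃ d : ℕ, d ∣ n ∧ 0 < d ∧ k = fd m h d }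

/-- The set `A_d(n,m) ⊆ ℤ_n`, with `c = ⌈m/d⌉ - 1`, `k = m - cd`,
`H = {j·(n/d) : j = 0,…,d-1}`:  `A_d(n,m) = ⋃_{i<c} (i+H) ∪ {c + j·(n/d) : j < k}`. -/
def Aset (n m d : ℕ) : Finset (ZMod n) :=
  ((Finset.range ((m + d - 1) / d - 1)) ×ˢ (Finset.range d)).image
    (fun p => (p.1 : ZMod n) + (p.2 : ZMod n) * ((n / d : ℕ) : ZMod n)) ∪
  (Finset.range (m - ((m + d - 1) / d - 1) * d)).image
    (fun j : ℕ => (((m + d - 1) / d - 1 : ℕ) : ZMod n) + (j : ZMod n) * ((n / d : ℕ) : ZMod n))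

/-- The set `B_d(n,m;k₁,k₂,g,j₀)` (with `c` such that `m = k₁ + (c-1)d + k₂`):
`{j·(n/d) : j < k₁} ∪ ⋃_{1 ≤ i ≤ c-1} (i·g + H) ∪ {c·g + (j₀+j)·(n/d) : j < k₂}`. -/
def Bset (n d k₁ k₂ c j₀ : ℕ) (g : ZMod n) : Finset (ZMod n) :=
  (Finset.range k₁).image (fun j : ℕ => (j : ZMod n) * ((n / d : ℕ) : ZMod n)) ∪
  ((Finset.Ico 1 c) ×ˢ (Finset.range d)).image
    (fun p => p.1 • g + (p.2 : ZMod n) * ((n / d : ℕ) : ZMod n)) ∪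
  (Finset.range k₂).image
    (fun j => c • g + ((j₀ + j : ℕ) : ZMod n) * ((n / d : ℕ) : ZMod n))

theorem aux_mem (G : Type*) [AddCommMonoid G] [DecidableEq G] (A : Finset G) (z : G) :
    z ∈ hFoldRSum 2 A ↔ ∃ x ∈ A, ∃ y ∈ A, x ≠ y ∧ x + y = z := by
  unfold hFoldRSum
  simp only [mem_image, mem_powersetCard]
  constructor
  · rintro ⟨s, ⟨hs, hc⟩, rfl⟩
    obtain ⟨x, y, hxy, rfl⟩ := card_eq_two.1 hc
    exact ⟨x, hs (by simp), y, hs (by simp), hxy, (sum_pair (f := fun x => x) hxy).symm⟩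
  · rintro ⟨x, hx, y, hy, hxy, rfl⟩
    refine ⟨{x, y}, ⟨?_, card_pair hxy⟩, sum_pair hxy⟩
    intro w hw
    simp only [mem_insert, mem_singleton] at hw
    rcases hw with rfl | rfl <;> assumption

theorem aux_rho (n m : ℕ) (hm : 3 ≤ m) (hmn : m ≤ n) :
    rhoHat (ZMod n) m 2 ≤ rho (ZMod n) m 2 := by
  have : NeZero n := ⟨by omega⟩
  have hne : { k | ∃ A : Finset (ZMod n), A.card = m ∧ (hFoldSum 2 A).card = k }.Nonempty := by
    obtain ⟨A, -, hA⟩ := Finset.exists_subset_card_eq (s := (Finset.univ : Finset (ZMod n))) (n := m)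
      (by rw [Finset.card_univ, ZMod.card]; exact hmn)
    exact ⟨_, A, hA, rfl⟩
  obtain ⟨A, hA, hk⟩ := Nat.sInf_mem hne
  unfold rho
  rw [← hk]
  refine le_trans (Nat.sInf_le ⟨A, hA, rfl⟩) (card_le_card ?_)
  intro z hz
  obtain ⟨x, hx, y, hy, -, rfl⟩ := (aux_mem _ _ _).1 hz
  unfold hFoldSum
  simp only [mem_image, Fintype.mem_piFinset]
  refine ⟨![x, y], ?_, by simp⟩
  intro i
  fin_cases i <;> simp [hx, hy]

theorem aux_bound (n N : ℕ) (hn : 0 < n) (hN : N ∣ n) (S T : Finset ℕ) (hS : ∀ x ∈ S, x < N)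
    (hST : ∀ x ∈ S, ∀ y ∈ S, x ≠ y → ∃ t ∈ T, x + y ≡ t [MOD N]) :
    rhoHat (ZMod n) S.card 2 ≤ T.card := by
  obtain ⟨e, rfl⟩ := hN
  have he : 0 < e := Nat.pos_of_mul_pos_left hn
  have key : ∀ a b : ℕ, ((a * e : ℕ) : ZMod (N * e)) = ((b * e : ℕ) : ZMod (N * e)) ↔ a ≡ b [MOD N] := by
    intro a b
    rw [ZMod.natCast_eq_natCast_iff]
    constructor
    · intro h
      exact Nat.ModEq.mul_right_cancel' he.ne' h
    · intro h
      exact Nat.ModEq.mul_right' e h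
  have hinj : Set.InjOn (fun a : ℕ => ((a * e : ℕ) : ZMod (N * e))) S := by
    intro a ha b hb hab
    exact Nat.ModEq.eq_of_lt_of_lt ((key a b).1 hab) (hS a ha) (hS b hb)
  refine le_trans (Nat.sInf_le ⟨S.image (fun a : ℕ => ((a * e : ℕ) : ZMod (N * e))),
    card_image_of_injOn hinj, rfl⟩) ?_
  refine le_trans (card_le_card (t := T.image (fun a : ℕ => ((a * e : ℕ) : ZMod (N * e)))) ?_)
    card_image_le
  intro z hz
  obtain ⟨x, hx, y, hy, hxy, rfl⟩ := (aux_mem _ _ _).1 hz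
  obtain ⟨a, ha, rfl⟩ := mem_image.1 hx
  obtain ⟨b, hb, rfl⟩ := mem_image.1 hy
  obtain ⟨t, ht, hab⟩ := hST a ha b hb (fun h => hxy (by rw [h]))
  refine mem_image.2 ⟨t, ht, ?_⟩
  have := (key _ _).2 hab
  rw [← this]
  push_cast
  ring

theorem aux_gen (n m : ℕ) (hm : 3 ≤ m) (hmn : m ≤ n) : rhoHat (ZMod n) m 2 ≤ 2 * m - 3 := by
  have := aux_bound n n (by omega) dvd_rfl (range m) (Icc 1 (2 * m - 3))
    (by intro x hx; have := mem_range.1 hx; omega)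
    (by
      intro x hx y hy hxy
      rw [mem_range] at hx hy
      exact ⟨x + y, mem_Icc.2 (by omega), Nat.ModEq.refl _⟩)
  simpa using this

theorem aux_even (e c : ℕ) (hc : 2 ≤ c) (hce : c ≤ e) :
    rhoHat (ZMod (2 * e)) (2 * c) 2 ≤ 2 * (2 * c) - 4 := by
  have := aux_bound (2 * e) (2 * e) (by omega) dvd_rfl (range c ∪ Ico e (e + c))
    (Icc 1 (2 * c - 3) ∪ Icc e (e + 2 * c - 2))
    (by intro x hx; simp only [mem_union, mem_range, mem_Ico] at hx; omega)
    (by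
      intro x hx y hy hxy
      simp only [mem_union, mem_range, mem_Ico] at hx hy
      simp only [mem_union, mem_Icc]
      by_cases h : e ≤ x ∧ e ≤ y
      · refine ⟨x + y - 2 * e, by omega, ?_⟩
        have h2 : x + y = (x + y - 2 * e) + 2 * e := by omega
        rw [h2]
        simp [Nat.ModEq]
      · exact ⟨x + y, by omega, Nat.ModEq.refl _⟩)
  rw [card_union_of_disjoint] at this
  · have h2 := card_union_le (Icc 1 (2 * c - 3)) (Icc e (e + 2 * c - 2))
    simp only [card_range, Nat.card_Ico, Nat.card_Icc] at this h2
    have h3 : c + (e + c - e) = 2 * c := by omega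
    rw [h3] at this
    omega
  · rw [disjoint_left]
    intro a ha hb
    simp only [mem_range, mem_Ico] at ha hb
    omega

theorem aux_odd (n c k : ℕ) (hn : 0 < n) (hc : 1 ≤ c) (hk : 1 ≤ k) (hd : 2 * c * (2 * k + 1) ∣ n) :
    rhoHat (ZMod n) (c * (2 * k + 1) + 1) 2 ≤ 2 * c * (2 * k + 1) - 2 := by
  set P : Finset (ℕ × ℕ) := (({0} ×ˢ range (k + 1)) ∪ (Ico 1 c ×ˢ range (2 * k + 1))) ∪
    ({c} ×ˢ Ico k (2 * k + 1)) with hP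
  have memP : ∀ p ∈ P, p.1 ≤ c ∧ p.2 < 2 * k + 1 ∧ (p.1 = 0 → p.2 ≤ k) ∧ (p.1 = c → k ≤ p.2) := by
    intro p hp
    simp only [hP, mem_union, mem_product, mem_singleton, mem_range, mem_Ico] at hp
    omega
  have cardP : P.card = c * (2 * k + 1) + 1 := by
    rw [hP, card_union_of_disjoint, card_union_of_disjoint]
    · simp only [card_product, card_singleton, card_range, Nat.card_Ico]
      obtain ⟨c, rfl⟩ : ∃ c', c = c' + 1 := ⟨c - 1, by omega⟩
      have : 2 * k + 1 - k = k + 1 := by omega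
      rw [this, Nat.add_sub_cancel]
      ring
    · rw [disjoint_left]
      intro a ha hb
      simp only [mem_product, mem_singleton, mem_range, mem_Ico] at ha hb
      omega
    · rw [disjoint_left]
      intro a ha hb
      simp only [mem_union, mem_product, mem_singleton, mem_range, mem_Ico] at ha hb
      omega
  have hinj : Set.InjOn (fun p : ℕ × ℕ => p.1 + 2 * c * p.2) P := by
    intro p hp q hq h
    have h1 := (memP p hp).1
    have h2 := (memP q hq).1
    simp only at h
    have h3 : p.1 = q.1 := by
      have := congrArg (· % (2 * c)) h
      simp only [Nat.add_mul_mod_self_left] at this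
      rwa [Nat.mod_eq_of_lt (by omega), Nat.mod_eq_of_lt (by omega)] at this
    have h4 : p.2 = q.2 := by
      rw [h3] at h
      exact Nat.eq_of_mul_eq_mul_left (by omega : 0 < 2 * c) (by omega)
    exact Prod.ext h3 h4
  have hNpos : 0 < 2 * c * (2 * k + 1) := by positivity
  have main := aux_bound n (2 * c * (2 * k + 1)) hn hd (P.image (fun p => p.1 + 2 * c * p.2))
    (((range (2 * c * (2 * k + 1))).erase 0).erase (2 * c * (2 * k)))
    (by
      intro x hx
      obtain ⟨p, hp, rfl⟩ := mem_image.1 hx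
      have h1 := memP p hp
      have : 2 * c * p.2 ≤ 2 * c * (2 * k) := Nat.mul_le_mul_left _ (by omega)
      rw [Nat.mul_add]
      omega)
    (by
      intro x hx y hy hxy
      obtain ⟨p, hp, rfl⟩ := mem_image.1 hx
      obtain ⟨q, hq, rfl⟩ := mem_image.1 hy
      have hpq : p ≠ q := fun h => hxy (by rw [h])
      have h1 := memP p hp
      have h2 := memP q hq
      obtain ⟨a, b⟩ := p
      obtain ⟨a', b'⟩ := q
      simp only at h1 h2 ⊢
      simp only [ne_eq, Prod.mk.injEq, not_and] at hpq
      have hs : ∀ v, v < 2 * k + 1 → (v = 0 ∨ v = 2 * k) →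
          ¬ (a + 2 * c * b + (a' + 2 * c * b')) % (2 * c * (2 * k + 1)) = 2 * c * v := by
        intro v hv hv' h
        have h3 : a + 2 * c * b + (a' + 2 * c * b') = (a + a') + 2 * c * (b + b') := by ring
        rw [h3] at h
        have h4 := Nat.mod_add_div ((a + a') + 2 * c * (b + b')) (2 * c * (2 * k + 1))
        rw [h] at h4
        set w := ((a + a') + 2 * c * (b + b')) / (2 * c * (2 * k + 1)) with hw
        clear_value w
        have h5 : 2 * c ∣ a + a' := by
          refine (Nat.dvd_add_left (Dvd.intro (b + b') rfl)).1 ?_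
          rw [← h4]
          exact ⟨v + (2 * k + 1) * w, by ring⟩
        obtain ⟨s, hs⟩ := h5
        have h6 : s + (b + b') = v + (2 * k + 1) * w := by
          apply Nat.eq_of_mul_eq_mul_left (by omega : 0 < 2 * c)
          rw [Nat.mul_add, ← hs, ← h4]
          ring
        have hs2 : s < 2 := by
          by_contra hcon
          have : 2 * c * 2 ≤ 2 * c * s := Nat.mul_le_mul_left _ (by omega)
          omega
        have hw2 : w < 2 := by
          by_contra hcon
          have : (2 * k + 1) * 2 ≤ (2 * k + 1) * w := Nat.mul_le_mul_left _ (by omega)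
          interval_cases s <;> omega
        interval_cases s <;> interval_cases w <;> omega
      have hs0 := hs 0 (by omega) (Or.inl rfl)
      rw [Nat.mul_zero] at hs0
      exact ⟨_, mem_erase.2 ⟨hs (2 * k) (by omega) (Or.inr rfl), mem_erase.2 ⟨hs0,
        mem_range.2 (Nat.mod_lt _ hNpos)⟩⟩, (Nat.mod_modEq _ _).symm⟩)
  rw [card_image_of_injOn hinj, cardP] at main
  rw [card_erase_of_mem, card_erase_of_mem, card_range] at main
  · omega
  · simpa using hNpos
  · simp only [mem_erase, mem_range]
    refine ⟨by positivity, Nat.mul_lt_mul_of_pos_left (by omega) (by omega)⟩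

theorem stmt14 (n m : ℕ) (hm : 3 ≤ m) (hmn : m ≤ n) :
    (((2 ∣ n ∧ 2 ∣ m) ∨ ((2 * m - 2) ∣ n ∧ ¬ ∃ k : ℕ, m - 1 = 2 ^ k)) →
      rhoHat (ZMod n) m 2 ≤ min (rho (ZMod n) m 2) (2 * m - 4)) ∧
    (¬ ((2 ∣ n ∧ 2 ∣ m) ∨ ((2 * m - 2) ∣ n ∧ ¬ ∃ k : ℕ, m - 1 = 2 ^ k)) →
      rhoHat (ZMod n) m 2 ≤ min (rho (ZMod n) m 2) (2 * m - 3)) := by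
  refine ⟨fun h => le_min (aux_rho n m hm hmn) ?_,
    fun _ => le_min (aux_rho n m hm hmn) (aux_gen n m hm hmn)⟩
  rcases h with ⟨⟨e, rfl⟩, ⟨c, rfl⟩⟩ | ⟨hd, hp⟩
  · exact aux_even e c (by omega) (by omega)
  · obtain ⟨a, d, hdo, hm1⟩ := Nat.exists_eq_two_pow_mul_odd (n := m - 1) (by omega)
    obtain ⟨k, rfl⟩ := hdo
    have hk : 1 ≤ k := by
      by_contra hk
      have : k = 0 := by omega
      subst this
      exact hp ⟨a, by simpa using hm1⟩
    have h1 : m = 2 ^ a * (2 * k + 1) + 1 := by omega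
    have h2 : 2 * m - 2 = 2 * 2 ^ a * (2 * k + 1) := by
      rw [Nat.mul_assoc]; omega
    have h3 := aux_odd n (2 ^ a) k (by omega) Nat.one_le_two_pow hk (h2 ▸ hd)
    rw [← h1, ← h2] at h3
    omega
end

section
/- For all positive integers n and m with 4 ≤ m ≤ n, the quantity ρ^(Z_n, m, 3) satisfies: ρ^(Z_n,m,3) ≤ min{u(n,m,3), 3m − 3 − gcd(n,m−1)} if gcd(n,m−1) ≥ 8; ρ^(Z_n,m,3) ≤ min{u(n,m,3), 3m − 10} if gcd(n,m−1) = 7, or if gcd(n,m−1) ≤ 5 and 3 | n and 3 | m, or if gcd(n,m−1) ≤ 5 and (3m−9) | n and 5 | (m−3); ρ^(Z_n,m,3) ≤ min{u(n,m,3), 3m − 9} if gcd(n,m−1) = 6, or if m = 6 and 10 | n but 3 ∤ n; and ρ^(Z_n,m,3) ≤ min{u(n,m,3), 3m − 8} otherwise. -/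
open Finset

lemma rho_le (n N m : ℕ) (hN : N ∣ n) (hn : 0 < n) (B S : Finset ℕ) (hB : ∀ x ∈ B, x < N)
    (hm : B.card = m)
    (hS : ∀ x ∈ B, ∀ y ∈ B, ∀ z ∈ B, x ≠ y → x ≠ z → y ≠ z → ∃ s ∈ S, x + y + z ≡ s [MOD N]) :
    rhoHat (ZMod n) m 3 ≤ S.card := by
  obtain ⟨w, rfl⟩ := hN
  have hw : 0 < w := Nat.pos_of_mul_pos_left hn
  let f : ℕ → ZMod (N * w) := fun x => ((w * x : ℕ) : ZMod (N * w))
  have hinj : Set.InjOn f (B : Set ℕ) := by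
    intro x hx y hy h
    have h1 := (ZMod.natCast_eq_natCast_iff _ _ _).1 h
    have hx' := hB x hx
    have hy' := hB y hy
    rw [mul_comm N w] at h1
    have h2 := Nat.ModEq.mul_left_cancel' hw.ne' h1
    exact Nat.ModEq.eq_of_lt_of_lt h2 hx' hy'
  have hsub : hFoldRSum 3 (B.image f) ⊆ S.image f := by
    intro v hv
    simp only [hFoldRSum, Finset.mem_image, Finset.mem_powersetCard] at hv
    obtain ⟨s, ⟨hsB, hs3⟩, rfl⟩ := hv
    obtain ⟨a, b, c, hab, hac, hbc, rfl⟩ := Finset.card_eq_three.1 hs3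
    have ha := hsB (show a ∈ ({a, b, c} : Finset _) by simp)
    have hb := hsB (show b ∈ ({a, b, c} : Finset _) by simp)
    have hc := hsB (show c ∈ ({a, b, c} : Finset _) by simp)
    obtain ⟨x, hx, rfl⟩ := Finset.mem_image.1 ha
    obtain ⟨y, hy, rfl⟩ := Finset.mem_image.1 hb
    obtain ⟨z, hz, rfl⟩ := Finset.mem_image.1 hc
    obtain ⟨s, hs, hmod⟩ := hS x hx y hy z hz (fun h => hab (by rw [h])) (fun h => hac (by rw [h]))
      (fun h => hbc (by rw [h]))
    refine Finset.mem_image.2 ⟨s, hs, ?_⟩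
    rw [Finset.sum_insert (by simp [hab, hac]), Finset.sum_insert (by simp [hbc]),
      Finset.sum_singleton]
    have h1 : ((w * (x + y + z) : ℕ) : ZMod (N * w)) = ((w * s : ℕ) : ZMod (N * w)) := by
      rw [ZMod.natCast_eq_natCast_iff, mul_comm N w]
      exact Nat.ModEq.mul_left' w hmod
    simp only [f]
    rw [← h1]
    push_cast
    ring
  have h1 : rhoHat (ZMod (N * w)) m 3 ≤ (hFoldRSum 3 (B.image f)).card :=
    Nat.sInf_le ⟨B.image f, by rw [Finset.card_image_of_injOn hinj, hm], rfl⟩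
  exact h1.trans ((Finset.card_le_card hsub).trans Finset.card_image_le)

def blk (q d : ℕ) (I : Finset ℕ) : Finset ℕ := (I ×ˢ Finset.range d).image fun p => p.1 + q * p.2

lemma mem_blk {q d : ℕ} {I : Finset ℕ} {x : ℕ} :
    x ∈ blk q d I ↔ ∃ i ∈ I, ∃ j < d, x = i + q * j := by
  simp only [blk, Finset.mem_image, Finset.mem_product, Finset.mem_range, Prod.exists]
  constructor
  · rintro ⟨i, j, ⟨h1, h2⟩, h3⟩
    exact ⟨i, h1, j, h2, h3.symm⟩
  · rintro ⟨i, h1, j, h2, h3⟩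
    exact ⟨i, j, ⟨h1, h2⟩, h3.symm⟩

lemma blk_card_le (q d : ℕ) (I : Finset ℕ) : (blk q d I).card ≤ I.card * d := by
  refine Finset.card_image_le.trans ?_
  simp

lemma eq_of_rep {q i j i' j' : ℕ} (hi : i < q) (hi' : i' < q) (h : i + q * j = i' + q * j') :
    i = i' ∧ j = j' := by
  have h1 : (i + q * j) % q = i := by rw [Nat.add_mul_mod_self_left, Nat.mod_eq_of_lt hi]
  have h2 : (i' + q * j') % q = i' := by rw [Nat.add_mul_mod_self_left, Nat.mod_eq_of_lt hi']
  have h3 : i = i' := by rw [← h1, ← h2, h]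
  refine ⟨h3, ?_⟩
  subst h3
  exact Nat.eq_of_mul_eq_mul_left (by omega : 0 < q) (by omega)

lemma blk_card (q d c : ℕ) (hc : c ≤ q) : (blk q d (Finset.range c)).card = c * d := by
  rw [blk, Finset.card_image_of_injOn]
  · simp
  · rintro ⟨i, j⟩ h ⟨i', j'⟩ h' he
    simp at h h'
    obtain ⟨h1, h2⟩ := eq_of_rep (by omega) (by omega) he
    exact Prod.ext h1 h2

lemma blk_lt {q d c : ℕ} (hc : c ≤ q) {x : ℕ} (hx : x ∈ blk q d (Finset.range c)) :
    x < q * d := by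
  obtain ⟨i, hi, j, hj, rfl⟩ := mem_blk.1 hx
  rw [Finset.mem_range] at hi
  have : q * (j + 1) ≤ q * d := Nat.mul_le_mul_left _ hj
  rw [mul_add] at this
  omega

lemma red {q d : ℕ} {I : Finset ℕ} (hd : 0 < d) (i j : ℕ) (hi : i ∈ I) :
    ∃ s ∈ blk q d I, i + q * j ≡ s [MOD (q * d)] := by
  refine ⟨i + q * (j % d), mem_blk.2 ⟨i, hi, j % d, Nat.mod_lt _ hd, rfl⟩, ?_⟩
  exact Nat.ModEq.add_left _ (Nat.ModEq.mul_left' q (Nat.mod_modEq j d).symm)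

lemma rho_le_fd (n m d : ℕ) (hm : 4 ≤ m) (hmn : m ≤ n) (hd : d ∣ n) (hd0 : 0 < d) :
    rhoHat (ZMod n) m 3 ≤ fd m 3 d := by
  obtain ⟨q, rfl⟩ := hd
  set c := (m + d - 1) / d with hc
  have h1 : m ≤ c * d := by
    have := Nat.lt_div_mul_add (a := m + d - 1) hd0
    rw [← hc] at this
    omega
  have hcq : c ≤ q := by
    rw [hc, ← Nat.lt_succ_iff, Nat.div_lt_iff_lt_mul hd0, Nat.succ_mul, mul_comm q d]
    omega
  have hc1 : 1 ≤ c := by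
    rcases Nat.eq_zero_or_pos c with h | h
    · rw [h] at h1; omega
    · exact h
  obtain ⟨B, hB, hBm⟩ := Finset.exists_subset_card_eq
    (show m ≤ (blk q d (Finset.range c)).card by rw [blk_card _ _ _ hcq]; exact h1)
  refine (rho_le (d * q) (q * d) m (by rw [mul_comm]) (by omega) B (blk q d (Finset.range (3 * c - 2)))
    (fun x hx => blk_lt hcq (hB hx)) hBm ?_).trans ?_
  · intro x hx y hy z hz _ _ _
    obtain ⟨i, hi, j, hj, rfl⟩ := mem_blk.1 (hB hx)
    obtain ⟨i', hi', j', hj', rfl⟩ := mem_blk.1 (hB hy)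
    obtain ⟨i'', hi'', j'', hj'', rfl⟩ := mem_blk.1 (hB hz)
    rw [Finset.mem_range] at hi hi' hi''
    have := red (q := q) (d := d) (I := Finset.range (3 * c - 2)) hd0 (i + i' + i'') (j + j' + j'')
      (by rw [Finset.mem_range]; omega)
    convert this using 4
    ring
  · refine (blk_card_le _ _ _).trans ?_
    rw [Finset.card_range, fd, ← hc]
    apply Nat.mul_le_mul_right
    omega

lemma rho_le_u (n m : ℕ) (hm : 4 ≤ m) (hmn : m ≤ n) : rhoHat (ZMod n) m 3 ≤ uFun n m 3 := by
  have hne : { k | ∃ d : ℕ, d ∣ n ∧ 0 < d ∧ k = fd m 3 d }.Nonempty := ⟨_, 1, one_dvd n, one_pos, rfl⟩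
  obtain ⟨d, h1, h2, h3⟩ := Nat.sInf_mem hne
  rw [uFun, h3]
  exact rho_le_fd n m d hm hmn h1 h2

lemma rho_a (n m d : ℕ) (hm : 4 ≤ m) (hmn : m ≤ n) (hd : d ∣ n) (hdm : d ∣ m - 1) :
    rhoHat (ZMod n) m 3 ≤ 3 * m - 3 - d := by
  obtain ⟨q, rfl⟩ := hd
  obtain ⟨c, hc⟩ := hdm
  have hd0 : 0 < d := by
    rcases Nat.eq_zero_or_pos d with h | h
    · rw [h] at hc; omega
    · exact h
  have hc1 : 1 ≤ c := by
    rcases Nat.eq_zero_or_pos c with h | h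
    · rw [h] at hc; omega
    · exact h
  have hcq : c < q := Nat.lt_of_mul_lt_mul_left (a := d) (by omega)
  have hnot : c ∉ blk q d (Finset.range c) := by
    intro h
    obtain ⟨i, hi, j, hj, h⟩ := mem_blk.1 h
    rw [Finset.mem_range] at hi
    have := (eq_of_rep (q := q) (i := c) (j := 0) (i' := i) (j' := j) hcq (by omega) (by simpa using h)).1
    omega
  have hmem : ∀ x ∈ insert c (blk q d (Finset.range c)), ∃ i j, i ≤ c ∧ j < d ∧ x = i + q * j ∧ (i = c → x = c) := by
    intro x hx
    rcases Finset.mem_insert.1 hx with rfl | hx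
    · exact ⟨x, 0, le_rfl, hd0, by simp, fun _ => rfl⟩
    · obtain ⟨i, hi, j, hj, rfl⟩ := mem_blk.1 hx
      rw [Finset.mem_range] at hi
      exact ⟨i, j, hi.le, hj, rfl, fun h => by omega⟩
  refine (rho_le (d * q) (q * d) m (by rw [mul_comm]) (by omega) (insert c (blk q d (Finset.range c)))
    (blk q d (Finset.range (3 * c - 1))) ?_ ?_ ?_).trans ?_
  · intro x hx
    rcases Finset.mem_insert.1 hx with rfl | hx
    · exact lt_of_lt_of_le hcq (Nat.le_mul_of_pos_right _ hd0)
    · exact blk_lt hcq.le hx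
  · rw [Finset.card_insert_of_notMem hnot, blk_card _ _ _ hcq.le, mul_comm]
    omega
  · intro x hx y hy z hz hxy hxz hyz
    obtain ⟨i, j, hi, hj, h1, h2⟩ := hmem x hx
    obtain ⟨i', j', hi', hj', h1', h2'⟩ := hmem y hy
    obtain ⟨i'', j'', hi'', hj'', h1'', h2''⟩ := hmem z hz
    have := red (q := q) (d := d) (I := Finset.range (3 * c - 1)) hd0 (i + i' + i'') (j + j' + j'')
      (by rw [Finset.mem_range]; omega)
    convert this using 4
    rw [h1, h1', h1'']
    ring
  · refine (blk_card_le _ _ _).trans ?_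
    rw [Finset.card_range, Nat.sub_mul, mul_assoc, mul_comm c d, ← hc]
    omega

lemma rho_b (n m : ℕ) (hm : 4 ≤ m) (hmn : m ≤ n) : rhoHat (ZMod n) m 3 ≤ 3 * m - 8 := by
  refine (rho_le n n m dvd_rfl (by omega) (Finset.range m) (Finset.Ico 3 (3 * m - 5)) ?_ (by simp) ?_).trans ?_
  · intro x hx
    rw [Finset.mem_range] at hx
    omega
  · intro x hx y hy z hz hxy hxz hyz
    rw [Finset.mem_range] at hx hy hz
    exact ⟨x + y + z, Finset.mem_Ico.2 (by omega), rfl⟩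
  · simp
    omega

lemma rho_c (n m : ℕ) (hm : 4 ≤ m) (hmn : m ≤ n) (h3 : 3 ∣ n) (h3m : 3 ∣ m) :
    rhoHat (ZMod n) m 3 ≤ 3 * m - 10 := by
  obtain ⟨q, rfl⟩ := h3
  obtain ⟨c, rfl⟩ := h3m
  have hcq : c ≤ q := by omega
  refine (rho_le (3 * q) (q * 3) (3 * c) (by rw [mul_comm]) (by omega) (blk q 3 (Finset.range c))
    ({0, 3 * (c - 1)} ∪ blk q 3 (Finset.Ico 1 (3 * c - 3)))
    (fun x hx => blk_lt hcq hx) (by rw [blk_card _ _ _ hcq, mul_comm]) ?_).trans ?_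
  · intro x hx y hy z hz hxy hxz hyz
    obtain ⟨i, hi, j, hj, rfl⟩ := mem_blk.1 hx
    obtain ⟨i', hi', j', hj', rfl⟩ := mem_blk.1 hy
    obtain ⟨i'', hi'', j'', hj'', rfl⟩ := mem_blk.1 hz
    rw [Finset.mem_range] at hi hi' hi''
    have hsum : i + q * j + (i' + q * j') + (i'' + q * j'') = (i + i' + i'') + q * (j + j' + j'') := by
      ring
    rw [hsum]
    by_cases hmid : i + i' + i'' ∈ Finset.Ico 1 (3 * c - 3)
    · obtain ⟨s, hs, h⟩ := red (q := q) (d := 3) (by norm_num) (i + i' + i'') (j + j' + j'') hmid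
      exact ⟨s, Finset.mem_union_right _ hs, h⟩
    · rw [Finset.mem_Ico] at hmid
      have hii : i = i' ∧ i = i'' := by omega
      obtain ⟨rfl, rfl⟩ := hii
      have e1 : j ≠ j' := fun h => hxy (by rw [h])
      have e2 : j ≠ j'' := fun h => hxz (by rw [h])
      have e3 : j' ≠ j'' := fun h => hyz (by rw [h])
      have hJ : j + j' + j'' = 3 := by omega
      rw [hJ]
      refine ⟨i + i + i, Finset.mem_union_left _ ?_, ?_⟩
      · simp only [Finset.mem_insert, Finset.mem_singleton]
        omega
      · simp [Nat.ModEq]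
  · refine (Finset.card_union_le _ _).trans ?_
    have h1 := blk_card_le q 3 (Finset.Ico 1 (3 * c - 3))
    have h2 : ({0, 3 * (c - 1)} : Finset ℕ).card ≤ 2 := Finset.card_le_two
    rw [Nat.card_Ico] at h1
    omega

lemma ar1 {a b c k : ℕ} (ha : a < 5) (hb : b < 5) (hc : c < 5) (h1 : a ≠ b) (h2 : a ≠ c)
    (h3 : b ≠ c) (a1 : a ≠ 4) (a2 : b ≠ 4) (a3 : c ≠ 4) (h : (a + b + c) = 5 * k + 2) : False := by
  interval_cases a <;> interval_cases b <;> first | omega | (interval_cases c <;> omega)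

lemma ar2 {a b c k : ℕ} (ha : a < 5) (hb : b < 5) (hc : c < 5) (h1 : a ≠ b) (h2 : a ≠ c)
    (h3 : b ≠ c) (a1 : a ≠ 2) (a2 : b ≠ 2) (a3 : c ≠ 2) (h : 1 + (a + b + c) = 5 * k + 2) : False := by
  interval_cases a <;> interval_cases b <;> first | omega | (interval_cases c <;> omega)

lemma rho_d (n m : ℕ) (hm : 4 ≤ m) (hmn : m ≤ n) (h1 : (3 * m - 9) ∣ n) (h2 : 5 ∣ m - 3) :
    rhoHat (ZMod n) m 3 ≤ 3 * m - 10 := by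
  obtain ⟨t, ht⟩ := h2
  have ht0 : 1 ≤ t := by omega
  have hN : 3 * t * 5 = 3 * m - 9 := by omega
  have hq : t + 1 ≤ 3 * t := by omega
  have m1 : 12 * t ∈ blk (3 * t) 5 (Finset.range (t + 1)) :=
    mem_blk.2 ⟨0, by simp, 4, by norm_num, by ring⟩
  have m2 : 7 * t ∈ (blk (3 * t) 5 (Finset.range (t + 1))).erase (12 * t) :=
    Finset.mem_erase.2 ⟨by omega, mem_blk.2 ⟨t, by simp, 2, by norm_num, by ring⟩⟩
  refine (rho_le n (3 * t * 5) m (by rw [hN]; exact h1) (by omega)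
    (((blk (3 * t) 5 (Finset.range (t + 1))).erase (12 * t)).erase (7 * t))
    ((Finset.range (3 * t * 5)).erase (6 * t)) ?_ ?_ ?_).trans ?_
  · intro x hx
    exact blk_lt hq (Finset.mem_of_mem_erase (Finset.mem_of_mem_erase hx))
  · rw [Finset.card_erase_of_mem m2, Finset.card_erase_of_mem m1, blk_card _ _ _ hq]
    omega
  · intro x hx y hy z hz hxy hxz hyz
    refine ⟨(x + y + z) % (3 * t * 5), ?_, (Nat.mod_modEq _ _).symm⟩
    rw [Finset.mem_erase, Finset.mem_range]
    refine ⟨?_, Nat.mod_lt _ (by omega)⟩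
    simp only [Finset.mem_erase] at hx hy hz
    obtain ⟨hx1, hx2, hx⟩ := hx
    obtain ⟨hy1, hy2, hy⟩ := hy
    obtain ⟨hz1, hz2, hz⟩ := hz
    obtain ⟨i, hi, j, hj, rfl⟩ := mem_blk.1 hx
    obtain ⟨i', hi', j', hj', rfl⟩ := mem_blk.1 hy
    obtain ⟨i'', hi'', j'', hj'', rfl⟩ := mem_blk.1 hz
    rw [Finset.mem_range] at hi hi' hi''
    intro h
    have key := Nat.div_add_mod (i + 3 * t * j + (i' + 3 * t * j') + (i'' + 3 * t * j'')) (3 * t * 5)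
    rw [h] at key
    generalize (i + 3 * t * j + (i' + 3 * t * j') + (i'' + 3 * t * j'')) / (3 * t * 5) = k at key
    have key2 : (i + i' + i'') + 3 * t * (j + j' + j'') = 3 * t * (5 * k + 2) := by linarith
    have hdvd : 3 * t ∣ i + i' + i'' := by
      rw [Nat.dvd_add_iff_left (Dvd.intro _ rfl : 3 * t ∣ 3 * t * (j + j' + j''))]
      rw [key2]; exact Dvd.intro _ rfl
    have hcases : i + i' + i'' = 0 ∨ i + i' + i'' = 3 * t := by
      obtain ⟨e, he⟩ := hdvd
      have : e < 2 := by
        by_contra! hh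
        have := Nat.mul_le_mul_left (3 * t) hh
        omega
      interval_cases e
      · left; omega
      · right; omega
    rcases hcases with h0 | h0
    · obtain rfl : i = 0 := by omega
      obtain rfl : i' = 0 := by omega
      obtain rfl : i'' = 0 := by omega
      have e1 : j ≠ j' := fun h => hxy (by rw [h])
      have e2 : j ≠ j'' := fun h => hxz (by rw [h])
      have e3 : j' ≠ j'' := fun h => hyz (by rw [h])
      have a1 : j ≠ 4 := fun h => hx2 (by rw [h]; ring)
      have a2 : j' ≠ 4 := fun h => hy2 (by rw [h]; ring)
      have a3 : j'' ≠ 4 := fun h => hz2 (by rw [h]; ring)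
      have := Nat.eq_of_mul_eq_mul_left (show 0 < 3 * t by omega)
        (show 3 * t * (j + j' + j'') = 3 * t * (5 * k + 2) by omega)
      exact ar1 hj hj' hj'' e1 e2 e3 a1 a2 a3 this
    · obtain rfl : i = t := by omega
      obtain rfl : i' = i := by omega
      obtain rfl : i'' = i' := by omega
      have e1 : j ≠ j' := fun h => hxy (by rw [h])
      have e2 : j ≠ j'' := fun h => hxz (by rw [h])
      have e3 : j' ≠ j'' := fun h => hyz (by rw [h])
      have a1 : j ≠ 2 := fun h => hx1 (by rw [h]; ring)
      have a2 : j' ≠ 2 := fun h => hy1 (by rw [h]; ring)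
      have a3 : j'' ≠ 2 := fun h => hz1 (by rw [h]; ring)
      have := Nat.eq_of_mul_eq_mul_left (show 0 < 3 * i'' by omega)
        (show 3 * i'' * (1 + (j + j' + j'')) = 3 * i'' * (5 * k + 2) by linarith)
      exact ar2 hj hj' hj'' e1 e2 e3 a1 a2 a3 this
  · rw [Finset.card_erase_of_mem (by rw [Finset.mem_range]; omega), Finset.card_range]
    omega

lemma rho_e (n : ℕ) (hn : 6 ≤ n) (h : 10 ∣ n) : rhoHat (ZMod n) 6 3 ≤ 9 := by
  refine (rho_le n 10 6 h (by omega) {0, 1, 2, 4, 5, 6} {0, 1, 2, 3, 5, 6, 7, 8, 9} (by decide) (by decide) ?_).trans (by decide)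
  unfold Nat.ModEq
  decide

theorem stmt15 (n m : ℕ) (hm : 4 ≤ m) (hmn : m ≤ n) :
    (8 ≤ Nat.gcd n (m - 1) →
      rhoHat (ZMod n) m 3 ≤ min (uFun n m 3) (3 * m - 3 - Nat.gcd n (m - 1))) ∧
    ((Nat.gcd n (m - 1) = 7 ∨ (Nat.gcd n (m - 1) ≤ 5 ∧ 3 ∣ n ∧ 3 ∣ m) ∨
        (Nat.gcd n (m - 1) ≤ 5 ∧ (3 * m - 9) ∣ n ∧ 5 ∣ (m - 3))) →
      rhoHat (ZMod n) m 3 ≤ min (uFun n m 3) (3 * m - 10)) ∧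
    ((Nat.gcd n (m - 1) = 6 ∨ (m = 6 ∧ 10 ∣ n ∧ ¬ 3 ∣ n)) →
      rhoHat (ZMod n) m 3 ≤ min (uFun n m 3) (3 * m - 9)) ∧
    ((¬ 8 ≤ Nat.gcd n (m - 1) ∧
      ¬ (Nat.gcd n (m - 1) = 7 ∨ (Nat.gcd n (m - 1) ≤ 5 ∧ 3 ∣ n ∧ 3 ∣ m) ∨
          (Nat.gcd n (m - 1) ≤ 5 ∧ (3 * m - 9) ∣ n ∧ 5 ∣ (m - 3))) ∧
      ¬ (Nat.gcd n (m - 1) = 6 ∨ (m = 6 ∧ 10 ∣ n ∧ ¬ 3 ∣ n))) →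
      rhoHat (ZMod n) m 3 ≤ min (uFun n m 3) (3 * m - 8)) := by
  have hu := rho_le_u n m hm hmn
  have hg := rho_a n m _ hm hmn (Nat.gcd_dvd_left n (m - 1)) (Nat.gcd_dvd_right n (m - 1))
  refine ⟨fun _ => le_min hu hg, ?_, ?_, fun _ => le_min hu (rho_b n m hm hmn)⟩
  · rintro (h | ⟨_, h1, h2⟩ | ⟨_, h1, h2⟩)
    · rw [h] at hg
      exact le_min hu (by omega)
    · exact le_min hu (rho_c n m hm hmn h1 h2)
    · exact le_min hu (rho_d n m hm hmn h1 h2)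
  · rintro (h | ⟨rfl, h, _⟩)
    · rw [h] at hg
      exact le_min hu (by omega)
    · exact le_min hu (rho_e n hmn h)
end

section
/- For all positive integers n and m with 3 ≤ m ≤ n: u^(n,m,2) = min{u(n,m,2), 2m − 4} if 2 divides both n and m, and u^(n,m,2) = min{u(n,m,2), 2m − 3} otherwise. Here u^(n,m,2) = min over positive divisors d of n of |2^A_d(n,m)|. -/
open Finset

/-- `u^(n,m,h) = min { |h^A_d(n,m)| : d ∣ n, d > 0 }`. -/
noncomputable def uHat (n m h : ℕ) : ℕ :=
  sInf { k | ∃ d : ℕ, d ∣ n ∧ 0 < d ∧ k = (hFoldRSum h (Aset n m d)).card }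

lemma mem_rsum {n : ℕ} (A : Finset (ZMod n)) (x : ZMod n) :
    x ∈ hFoldRSum 2 A ↔ ∃ a ∈ A, ∃ b ∈ A, a ≠ b ∧ x = a + b := by
  unfold hFoldRSum
  simp only [mem_image, mem_powersetCard]
  constructor
  · rintro ⟨s, ⟨hs, hc⟩, rfl⟩
    obtain ⟨a, b, hab, rfl⟩ := Finset.card_eq_two.1 hc
    exact ⟨a, hs (by simp), b, hs (by simp), hab, by rw [Finset.sum_pair hab]⟩
  · rintro ⟨a, ha, b, hb, hab, rfl⟩
    refine ⟨{a, b}, ⟨?_, Finset.card_pair hab⟩, Finset.sum_pair hab⟩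
    intro x hx
    simp only [mem_insert, mem_singleton] at hx
    rcases hx with rfl | rfl <;> assumption

/-- coordinates -/
def ph (n q i j : ℕ) : ZMod n := ((i + j * q : ℕ) : ZMod n)

lemma ph_add (n q i j i' j' : ℕ) : ph n q i j + ph n q i' j' = ph n q (i + i') (j + j') := by
  unfold ph; push_cast; ring

lemma ph_inj {n d q i j i' j' : ℕ} (hn : n = d * q) (hi : i < q) (hj : j < d) (hi' : i' < q)
    (hj' : j' < d) (h : ph n q i j = ph n q i' j') : i = i' ∧ j = j' := by
  unfold ph at h
  have key : ∀ i j, i < q → j < d → i + j * q < n := by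
    intro i j hi hj
    have : (j + 1) * q ≤ d * q := Nat.mul_le_mul_right _ hj
    rw [hn]; linarith
  rw [ZMod.natCast_eq_natCast_iff] at h
  have h2 : i + j * q = i' + j' * q := Nat.ModEq.eq_of_lt_of_lt h (key _ _ hi hj) (key _ _ hi' hj')
  have h3 : i = i' := by
    have := congrArg (· % q) h2
    simpa [Nat.add_mul_mod_self_right, Nat.mod_eq_of_lt hi, Nat.mod_eq_of_lt hi'] using this
  refine ⟨h3, ?_⟩
  subst h3
  exact Nat.eq_of_mul_eq_mul_right (by omega : 0 < q) (by omega)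

lemma ph_eq {n d q i j j' : ℕ} (hn : n = d * q) (h : j ≡ j' [MOD d]) :
    ph n q i j = ph n q i j' := by
  unfold ph
  rw [ZMod.natCast_eq_natCast_iff, hn]
  exact Nat.ModEq.add_left _ (Nat.ModEq.mul_right' q h)

lemma mem_Aset {n m d q c k : ℕ} (hn : n = d * q) (hm : m = c * d + k) (hk : 1 ≤ k) (hkd : k ≤ d)
    (x : ZMod n) : x ∈ Aset n m d ↔
      ∃ i j, ((i < c ∧ j < d) ∨ (i = c ∧ j < k)) ∧ x = ph n q i j := by
  have hd : 0 < d := by omega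
  have h1 : (m + d - 1) / d = c + 1 := by
    rw [Nat.div_eq_iff hd]
    have : (c + 1) * d = c * d + d := by ring
    constructor <;> omega
  have h2 : n / d = q := by rw [hn]; exact Nat.mul_div_cancel_left _ hd
  unfold Aset
  rw [h1, h2]
  have h3 : m - (c + 1 - 1) * d = k := by simp [hm]
  rw [h3]
  simp only [mem_union, mem_image, mem_product, mem_range, Prod.exists, ph]
  constructor
  · rintro (⟨i, j, h, rfl⟩ | ⟨j, h, rfl⟩)
    · exact ⟨i, j, Or.inl (by simpa using h), by push_cast; rfl⟩
    · exact ⟨c, j, Or.inr ⟨rfl, h⟩, by push_cast; simp⟩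
  · rintro ⟨i, j, (h | ⟨rfl, h⟩), rfl⟩
    · exact Or.inl ⟨i, j, by simpa using h, by push_cast; rfl⟩
    · exact Or.inr ⟨j, h, by push_cast; simp⟩

lemma fd_eq {m d c k : ℕ} (hm : m = c * d + k) (hk : 1 ≤ k) (hkd : k ≤ d) :
    fd m 2 d = (2 * c + 1) * d := by
  have hd : 0 < d := by omega
  have h1 : (m + d - 1) / d = c + 1 := by
    rw [Nat.div_eq_iff hd]
    have : (c + 1) * d = c * d + d := by ring
    constructor <;> omega
  unfold fd
  rw [h1]
  congr 1

lemma card_ge {n d q : ℕ} (hn : n = d * q) (a b : ℕ) (P : Finset (ℕ × ℕ)) (R : Finset (ZMod n))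
    (hP : P ⊆ range q ×ˢ range d) (h : ∀ i j, (i, j) ∈ P → ph n q (a + i) (b + j) ∈ R) :
    P.card ≤ R.card := by
  apply Finset.card_le_card_of_injOn (fun p => ph n q (a + p.1) (b + p.2))
  · rintro ⟨i, j⟩ hp
    exact h i j hp
  · rintro ⟨i, j⟩ hp ⟨i', j'⟩ hp' he
    have h1 := hP hp
    have h2 := hP hp'
    simp only [mem_product, mem_range] at h1 h2
    simp only [← ph_add] at he
    have := ph_inj hn h1.1 h1.2 h2.1 h2.2 (add_left_cancel he)
    rw [this.1, this.2]

lemma mem_R {n m d q c k : ℕ} (hn : n = d * q) (hm : m = c * d + k) (hk : 1 ≤ k) (hkd : k ≤ d)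
    (hcq : c < q) (x : ZMod n) : x ∈ hFoldRSum 2 (Aset n m d) ↔
      ∃ i j i' j', ((i < c ∧ j < d) ∨ (i = c ∧ j < k)) ∧ ((i' < c ∧ j' < d) ∨ (i' = c ∧ j' < k)) ∧
        (i ≠ i' ∨ j ≠ j') ∧ x = ph n q (i + i') (j + j') := by
  rw [mem_rsum]
  constructor
  · rintro ⟨a, ha, b, hb, hab, rfl⟩
    rw [mem_Aset hn hm hk hkd] at ha hb
    obtain ⟨i, j, h, rfl⟩ := ha
    obtain ⟨i', j', h', rfl⟩ := hb
    refine ⟨i, j, i', j', h, h', ?_, ph_add ..⟩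
    by_contra hc
    push Not at hc
    exact hab (by rw [hc.1, hc.2])
  · rintro ⟨i, j, i', j', h, h', hne, rfl⟩
    refine ⟨_, (mem_Aset hn hm hk hkd _).2 ⟨i, j, h, rfl⟩, _,
      (mem_Aset hn hm hk hkd _).2 ⟨i', j', h', rfl⟩, ?_, (ph_add ..).symm⟩
    intro he
    have := ph_inj hn (by omega) (by omega) (by omega) (by omega) he
    omega

lemma full1 {n m d q c k : ℕ} (hn : n = d * q) (hm : m = c * d + k) (hk : 1 ≤ k) (hkd : k ≤ d)
    (hcq : c < q) (s t : ℕ) (hs : 1 ≤ s) (hs' : s < 2 * c) :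
    ph n q s t ∈ hFoldRSum 2 (Aset n m d) := by
  rw [mem_R hn hm hk hkd hcq]
  have hd : t % d < d := Nat.mod_lt _ (by omega)
  refine ⟨s - min s c, t % d, min s c, 0, by omega, by omega, by omega, ?_⟩
  rw [Nat.sub_add_cancel (min_le_left _ _), add_zero]
  exact ph_eq hn (Nat.mod_modEq t d).symm

lemma full0 {n m d q c k : ℕ} (hn : n = d * q) (hm : m = c * d + k) (hk : 1 ≤ k) (hkd : k ≤ d)
    (hcq : c < q) (t : ℕ) (hc : 1 ≤ c) (ht : 3 ≤ d ∨ t % d ≠ 0) :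
    ph n q 0 t ∈ hFoldRSum 2 (Aset n m d) := by
  rw [mem_R hn hm hk hkd hcq]
  have hd : t % d < d := Nat.mod_lt _ (by omega)
  by_cases h0 : t % d = 0
  · refine ⟨0, 1, 0, d - 1, by omega, by omega, by omega, ?_⟩
    apply ph_eq hn
    have : 1 + (d - 1) = d := by omega
    rw [this]
    simp [Nat.ModEq, h0]
  · refine ⟨0, 0, 0, t % d, by omega, by omega, by omega, ?_⟩
    rw [zero_add, zero_add]
    exact ph_eq hn (Nat.mod_modEq t d).symm

lemma top {n m d q c k : ℕ} (hn : n = d * q) (hm : m = c * d + k) (hk : 1 ≤ k) (hkd : k ≤ d)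
    (hcq : c < q) (t : ℕ) (ht : 1 ≤ t) (ht' : t ≤ 2 * k - 3) :
    ph n q (2 * c) t ∈ hFoldRSum 2 (Aset n m d) := by
  rw [mem_R hn hm hk hkd hcq]
  refine ⟨c, t - min t (k - 1), c, min t (k - 1), by omega, by omega, by omega, ?_⟩
  rw [Nat.sub_add_cancel (min_le_left _ _), two_mul]

lemma upper1 {n m d q c k : ℕ} (hn : n = d * q) (hm : m = c * d + k) (hk : 1 ≤ k) (hkd : k ≤ d)
    (hcq : c < q) : (hFoldRSum 2 (Aset n m d)).card ≤ (2 * c + 1) * d := by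
  have : hFoldRSum 2 (Aset n m d) ⊆
      (range (2 * c + 1) ×ˢ range d).image (fun p => ph n q p.1 p.2) := by
    intro x hx
    rw [mem_R hn hm hk hkd hcq] at hx
    obtain ⟨i, j, i', j', h, h', hne, rfl⟩ := hx
    rw [mem_image]
    refine ⟨(i + i', (j + j') % d), ?_, ph_eq hn (Nat.mod_modEq _ d)⟩
    have hd : (j + j') % d < d := Nat.mod_lt _ (by omega)
    simp only [mem_product, mem_range]
    omega
  refine (card_le_card this).trans (card_image_le.trans ?_)
  simp

lemma upper2 {n m : ℕ} (hm : 3 ≤ m) (hmn : m ≤ n) :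
    (hFoldRSum 2 (Aset n m 1)).card ≤ 2 * m - 3 := by
  have : hFoldRSum 2 (Aset n m 1) ⊆
      (range (2 * m - 3)).image (fun p => ph n n (p + 1) 0) := by
    intro x hx
    rw [mem_R (q := n) (c := m - 1) (k := 1) (by omega) (by omega) (by omega) (by omega)
      (by omega)] at hx
    obtain ⟨i, j, i', j', h, h', hne, rfl⟩ := hx
    rw [mem_image]
    refine ⟨i + i' - 1, by rw [mem_range]; omega, ?_⟩
    have h1 : i + i' - 1 + 1 = i + i' := by omega
    have h2 : j + j' = 0 := by omega
    simp only [h1, h2]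
  refine (card_le_card this).trans (card_image_le.trans ?_)
  simp

lemma upper3 {n m q c : ℕ} (hn : n = 2 * q) (hm : m = c * 2 + 2) (hc : 1 ≤ c) (hcq : c < q) :
    (hFoldRSum 2 (Aset n m 2)).card ≤ 2 * m - 4 := by
  have : hFoldRSum 2 (Aset n m 2) ⊆
      (insert (0, 1) (insert (2 * c, 1) (Ico 1 (2 * c) ×ˢ range 2))).image
        (fun p => ph n q p.1 p.2) := by
    intro x hx
    rw [mem_R hn hm (by omega) le_rfl hcq] at hx
    obtain ⟨i, j, i', j', h, h', hne, rfl⟩ := hx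
    rw [mem_image]
    refine ⟨(i + i', (j + j') % 2), ?_, ph_eq hn (Nat.mod_modEq _ 2)⟩
    simp only [mem_product, mem_range, mem_insert, mem_Ico, Prod.mk.injEq]
    omega
  refine (card_le_card this).trans (card_image_le.trans ?_)
  refine (card_insert_le _ _).trans ?_
  refine (Nat.add_le_add_right (card_insert_le _ _) 1).trans ?_
  simp only [card_product, Nat.card_Ico, card_range]
  omega

lemma lower {n m d q c k : ℕ} (hn : n = d * q) (hm : m = c * d + k) (hk : 1 ≤ k) (hkd : k ≤ d)
    (hcq : c < q) (hm3 : 3 ≤ m) :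
    n ≤ (hFoldRSum 2 (Aset n m d)).card ∨ (2 * c + 1) * d ≤ (hFoldRSum 2 (Aset n m d)).card ∨
    2 * m - 3 ≤ (hFoldRSum 2 (Aset n m d)).card ∨
    (d = 2 ∧ 2 ∣ m ∧ 2 * m - 4 ≤ (hFoldRSum 2 (Aset n m d)).card) := by
  by_cases hq : q + 1 ≤ 2 * c
  · left
    have := card_ge hn 1 0 (range q ×ˢ range d) (hFoldRSum 2 (Aset n m d)) (subset_refl _) (by
      intro i j h
      simp only [mem_product, mem_range] at h
      exact full1 hn hm hk hkd hcq _ _ (by omega) (by omega))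
    rw [card_product, card_range, card_range, mul_comm, ← hn] at this
    exact this
  by_cases hd1 : d = 1
  · subst hd1
    have hc : 2 * c - 1 ≤ q := by omega
    right; right; left
    have := card_ge hn 1 0 (range (2 * c - 1) ×ˢ range 1) (hFoldRSum 2 (Aset n m 1))
      (product_subset_product (range_subset_range.2 hc) (subset_refl _)) (by
      intro i j h
      simp only [mem_product, mem_range] at h
      exact full1 hn hm hk hkd hcq _ _ (by omega) (by omega))
    rw [card_product, card_range, card_range] at this
    omega
  by_cases hd2 : c = 0 ∨ 3 ≤ d
  · by_cases hq2 : q = 2 * c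
    · left
      have := card_ge hn 0 0 (range q ×ˢ range d) (hFoldRSum 2 (Aset n m d)) (subset_refl _) (by
        intro i j h
        simp only [mem_product, mem_range] at h
        rw [zero_add, zero_add]
        rcases Nat.eq_zero_or_pos i with rfl | hi
        · exact full0 hn hm hk hkd hcq _ (by omega) (by omega)
        · exact full1 hn hm hk hkd hcq _ _ (by omega) (by omega))
      rw [card_product, card_range, card_range, mul_comm, ← hn] at this
      exact this
    have := card_ge hn 0 1 ((range (2 * c) ×ˢ range d) ∪ ({2 * c} ×ˢ range (min d (2 * k - 3))))
      (hFoldRSum 2 (Aset n m d)) (by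
        rintro ⟨i, j⟩ h
        simp only [mem_union, mem_product, mem_range, mem_singleton] at h ⊢
        omega) (by
        intro i j h
        simp only [mem_union, mem_product, mem_range, mem_singleton] at h
        rw [zero_add]
        rcases h with h | ⟨rfl, h⟩
        · rcases Nat.eq_zero_or_pos i with rfl | hi
          · exact full0 hn hm hk hkd hcq _ (by omega) (by omega)
          · exact full1 hn hm hk hkd hcq _ _ (by omega) (by omega)
        · exact top hn hm hk hkd hcq _ (by omega) (by omega))
    rw [card_union_of_disjoint, card_product, card_product, card_range, card_range, card_range,
      card_singleton] at this
    · have e1 : (2 * c + 1) * d = 2 * (c * d) + d := by ring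
      have e2 : 2 * c * d = 2 * (c * d) := by ring
      rw [e2] at this
      rw [e1]
      omega
    · rw [Finset.disjoint_left]
      rintro ⟨i, j⟩ h h'
      simp only [mem_product, mem_range, mem_singleton] at h h'
      omega
  have hd : d = 2 := by omega
  subst hd
  have base : ∀ i j, (i, j) ∈ insert (0, 0) (Ico 1 (2 * c) ×ˢ range 2) →
      ph n q i (1 + j) ∈ hFoldRSum 2 (Aset n m 2) := by
    intro i j h
    simp only [mem_insert, mem_product, mem_range, mem_Ico, Prod.mk.injEq] at h
    rcases h with ⟨rfl, rfl⟩ | h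
    · exact full0 hn hm hk hkd hcq _ (by omega) (by omega)
    · exact full1 hn hm hk hkd hcq _ _ (by omega) (by omega)
  have hcard : (insert (0, 0) (Ico 1 (2 * c) ×ˢ range 2)).card = 4 * c - 1 := by
    rw [card_insert_of_notMem (by simp), card_product, Nat.card_Ico, card_range]
    omega
  rcases (by omega : k = 1 ∨ k = 2) with rfl | rfl
  · have := card_ge hn 0 1 (insert (0, 0) (Ico 1 (2 * c) ×ˢ range 2)) (hFoldRSum 2 (Aset n m 2))
      (by
        rintro ⟨i, j⟩ h
        simp only [mem_insert, mem_product, mem_range, mem_Ico, Prod.mk.injEq] at h ⊢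
        omega) (by
        intro i j h
        rw [zero_add]
        exact base i j h)
    omega
  · right; right; right
    refine ⟨rfl, by omega, ?_⟩
    have htop := top hn hm hk hkd hcq 1 le_rfl (by omega)
    by_cases hq2 : q = 2 * c
    · have := card_ge hn 0 1 (insert (0, 1) (insert (0, 0) (Ico 1 (2 * c) ×ˢ range 2)))
        (hFoldRSum 2 (Aset n m 2))
        (by
          rintro ⟨i, j⟩ h
          simp only [mem_insert, mem_product, mem_range, mem_Ico, Prod.mk.injEq] at h ⊢
          omega) (by
          intro i j h
          rw [zero_add]
          rw [mem_insert] at h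
          rcases h with h | h
          · simp only [Prod.mk.injEq] at h
            obtain ⟨rfl, rfl⟩ := h
            have : ph n q 0 (1 + 1) = ph n q (2 * c) 1 := by
              unfold ph; congr 1; omega
            rw [this]; exact htop
          · exact base i j h)
      rw [card_insert_of_notMem (by simp), hcard] at this
      omega
    · have := card_ge hn 0 1 (insert (2 * c, 0) (insert (0, 0) (Ico 1 (2 * c) ×ˢ range 2)))
        (hFoldRSum 2 (Aset n m 2))
        (by
          rintro ⟨i, j⟩ h
          simp only [mem_insert, mem_product, mem_range, mem_Ico, Prod.mk.injEq] at h ⊢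
          omega) (by
          intro i j h
          rw [zero_add]
          rw [mem_insert] at h
          rcases h with h | h
          · simp only [Prod.mk.injEq] at h
            obtain ⟨rfl, rfl⟩ := h
            exact htop
          · exact base i j h)
      rw [card_insert_of_notMem (by simp; omega), hcard] at this
      omega

lemma params {n m d : ℕ} (hm : 3 ≤ m) (hmn : m ≤ n) (hd : d ∣ n) (hd0 : 0 < d) :
    ∃ q c k, n = d * q ∧ m = c * d + k ∧ 1 ≤ k ∧ k ≤ d ∧ c < q := by
  obtain ⟨q, rfl⟩ := hd
  have h1 := Nat.div_add_mod (m - 1) d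
  have h2 := Nat.mod_lt (m - 1) hd0
  have h3 : m = (m - 1) / d * d + ((m - 1) % d + 1) := by rw [mul_comm]; omega
  refine ⟨q, (m - 1) / d, (m - 1) % d + 1, rfl, h3, by omega, by omega, ?_⟩
  rw [Nat.div_lt_iff_lt_mul hd0, mul_comm]
  omega

lemma uHat_le {n m d : ℕ} (hd : d ∣ n) (hd0 : 0 < d) :
    uHat n m 2 ≤ (hFoldRSum 2 (Aset n m d)).card := Nat.sInf_le ⟨d, hd, hd0, rfl⟩

lemma uFun_le {n m d : ℕ} (hd : d ∣ n) (hd0 : 0 < d) :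
    uFun n m 2 ≤ fd m 2 d := Nat.sInf_le ⟨d, hd, hd0, rfl⟩

lemma uHat_le_uFun {n m : ℕ} (hm : 3 ≤ m) (hmn : m ≤ n) : uHat n m 2 ≤ uFun n m 2 := by
  obtain ⟨d, hd, hd0, h⟩ : uFun n m 2 ∈ { k | ∃ d : ℕ, d ∣ n ∧ 0 < d ∧ k = fd m 2 d } :=
    Nat.sInf_mem ⟨_, 1, one_dvd _, one_pos, rfl⟩
  rw [h]
  obtain ⟨q, c, k, h1, h2, h3, h4, h5⟩ := params hm hmn hd hd0
  rw [fd_eq h2 h3 h4]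
  exact (uHat_le hd hd0).trans (upper1 h1 h2 h3 h4 h5)

lemma uHat_ge {n m : ℕ} (hm : 3 ≤ m) (hmn : m ≤ n) :
    uFun n m 2 ≤ uHat n m 2 ∨ 2 * m - 3 ≤ uHat n m 2 ∨
      ((2 ∣ n ∧ 2 ∣ m) ∧ 2 * m - 4 ≤ uHat n m 2) := by
  obtain ⟨d, hd, hd0, h⟩ : uHat n m 2 ∈
      { k | ∃ d : ℕ, d ∣ n ∧ 0 < d ∧ k = (hFoldRSum 2 (Aset n m d)).card } :=
    Nat.sInf_mem ⟨_, 1, one_dvd _, one_pos, rfl⟩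
  rw [h]
  obtain ⟨q, c, k, h1, h2, h3, h4, h5⟩ := params hm hmn hd hd0
  rcases lower h1 h2 h3 h4 h5 hm with h | h | h | ⟨rfl, h, h'⟩
  · left
    have := uFun_le (m := m) (dvd_refl n) (by omega)
    rw [fd_eq (c := 0) (k := m) (by omega) (by omega) hmn] at this
    omega
  · left
    have := uFun_le (m := m) hd hd0
    rw [fd_eq h2 h3 h4] at this
    omega
  · exact Or.inr (Or.inl h)
  · exact Or.inr (Or.inr ⟨⟨hd, h⟩, h'⟩)

theorem stmt16 (n m : ℕ) (hm : 3 ≤ m) (hmn : m ≤ n) :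
    ((2 ∣ n ∧ 2 ∣ m) → uHat n m 2 = min (uFun n m 2) (2 * m - 4)) ∧
    (¬ (2 ∣ n ∧ 2 ∣ m) → uHat n m 2 = min (uFun n m 2) (2 * m - 3)) := by
  have hu1 := uHat_le_uFun hm hmn
  have hu2 := (uHat_le (one_dvd n) one_pos).trans (upper2 hm hmn)
  have hl := uHat_ge hm hmn
  constructor
  · rintro ⟨⟨q, hq⟩, ⟨c, hc⟩⟩
    have hu3 := (uHat_le ⟨q, hq⟩ two_pos).trans
      (upper3 hq (show m = (c - 1) * 2 + 2 by omega) (by omega) (by omega))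
    omega
  · intro h
    have hl' : uFun n m 2 ≤ uHat n m 2 ∨ 2 * m - 3 ≤ uHat n m 2 := by tauto
    omega
end

section
/- For every integer n ≥ 3, ρ^(Z_n, ⌊n/2⌋ + 2, 2) = n; that is, every (⌊n/2⌋+2)-element subset A of Z_n satisfies 2^A = Z_n, and ⌊n/2⌋+2 is the smallest such cardinality guaranteeing this in the sense that the minimum of |2^A| over (⌊n/2⌋+2)-subsets is n. -/
open Finset

theorem stmt18_aux (n : ℕ) (hn : 3 ≤ n) (A : Finset (ZMod n)) (hA : A.card = n / 2 + 2)
    (x : ZMod n) : x ∈ hFoldRSum 2 A := by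
  haveI : NeZero n := ⟨by omega⟩
  have hB : (A.image (fun a => x - a)).card = n / 2 + 2 := by
    rw [Finset.card_image_of_injective _ sub_right_injective, hA]
  have h1 := Finset.card_union_add_card_inter A (A.image (fun a => x - a))
  have h2 : (A ∪ A.image (fun a => x - a)).card ≤ n := by
    have := Finset.card_le_univ (A ∪ A.image (fun a => x - a))
    rwa [ZMod.card] at this
  have h3 : 2 < (A ∩ A.image (fun a => x - a)).card := by omega
  have key : ∃ a ∈ A, x - a ∈ A ∧ a ≠ x - a := by
    by_contra hcon
    push Not at hcon
    have hall : ∀ a ∈ A ∩ A.image (fun a => x - a), a = x - a := by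
      intro a ha
      rw [Finset.mem_inter, Finset.mem_image] at ha
      obtain ⟨h, b, hb, rfl⟩ := ha
      apply hcon _ h
      simpa using hb
    obtain ⟨a, b, c, ha, hb, hc, hab, hac, hbc⟩ := Finset.two_lt_card_iff.1 h3
    have ea := hall a ha
    have eb := hall b hb
    have ec := hall c hc
    have hv : ∀ d, d = x - d → a ≠ d → 2 * (d - a).val = n := by
      intro d hd hne
      have : -(d - a) = d - a := by
        linear_combination ea - hd
      rcases (ZMod.neg_eq_self_iff _).1 this with h | h
      · exact absurd (sub_eq_zero.1 h).symm hne
      · exact h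
    have e1 := hv b eb hab
    have e2 := hv c ec hac
    have e3 : b - a = c - a := ZMod.val_injective n (by omega)
    exact hbc (sub_left_injective e3)
  obtain ⟨a, ha, hb, hne⟩ := key
  unfold hFoldRSum
  rw [Finset.mem_image]
  refine ⟨{a, x - a}, ?_, ?_⟩
  · rw [Finset.mem_powersetCard]
    refine ⟨?_, Finset.card_pair hne⟩
    intro y hy
    simp only [Finset.mem_insert, Finset.mem_singleton] at hy
    rcases hy with rfl | rfl <;> assumption
  · rw [Finset.sum_pair hne]; ring

theorem stmt18 (n : ℕ) (hn : 3 ≤ n) :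
    (∀ A : Finset (ZMod n), A.card = n / 2 + 2 → ∀ x : ZMod n, x ∈ hFoldRSum 2 A) ∧
    rhoHat (ZMod n) (n / 2 + 2) 2 = n := by
  haveI : NeZero n := ⟨by omega⟩
  have hfull : ∀ A : Finset (ZMod n), A.card = n / 2 + 2 → (hFoldRSum 2 A).card = n := by
    intro A hA
    rw [Finset.eq_univ_iff_forall.2 (stmt18_aux n hn A hA), Finset.card_univ, ZMod.card]
  refine ⟨stmt18_aux n hn, ?_⟩
  obtain ⟨A, -, hA⟩ := Finset.exists_subset_card_eq (s := (Finset.univ : Finset (ZMod n)))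
    (n := n / 2 + 2) (by rw [Finset.card_univ, ZMod.card]; omega)
  have hs : { k | ∃ A : Finset (ZMod n), A.card = n / 2 + 2 ∧ (hFoldRSum 2 A).card = k } = {n} := by
    ext k
    constructor
    · rintro ⟨B, hB, rfl⟩
      exact hfull B hB
    · rintro rfl
      exact ⟨A, hA, hfull A hA⟩
  unfold rhoHat
  rw [hs, csInf_singleton]
end

section
/- For every integer n ≥ 2: if n is a power of 2, then ρ^(Z_n, ⌊n/2⌋ + 1, 2) ≤ n − 1, and if n is not a power of 2, then ρ^(Z_n, ⌊n/2⌋ + 1, 2) ≤ n − 2. -/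
open Finset

lemma rhoHat_le_aux (n m : ℕ) (hn : 2 ≤ n) (B C : Finset ℕ) (hB : ∀ x ∈ B, x < n)
    (hC : ∀ x ∈ C, x < n) (hm : B.card = m)
    (h : ∀ a ∈ B, ∀ b ∈ B, a ≠ b → ∀ c ∈ C, ¬ n ∣ a + b + c) :
    rhoHat (ZMod n) m 2 ≤ n - C.card := by
  haveI : NeZero n := ⟨by omega⟩
  have inj : ∀ x < n, ∀ y < n, (x : ZMod n) = y → x = y := by
    intro x hx y hy hxy
    rw [ZMod.natCast_eq_natCast_iff] at hxy
    exact Nat.ModEq.eq_of_lt_of_lt hxy hx hy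
  let A : Finset (ZMod n) := B.image (fun x : ℕ => (x : ZMod n))
  let T : Finset (ZMod n) := C.image (fun x : ℕ => -(x : ZMod n))
  have hA : A.card = m := by
    rw [← hm]
    apply Finset.card_image_of_injOn
    intro x hx y hy hxy
    exact inj x (hB x hx) y (hB y hy) hxy
  have hT : T.card = C.card := by
    apply Finset.card_image_of_injOn
    intro x hx y hy hxy
    exact inj x (hC x hx) y (hC y hy) (neg_injective hxy)
  have hsub : hFoldRSum 2 A ⊆ Tᶜ := by
    intro z hz
    unfold hFoldRSum at hz
    rw [Finset.mem_image] at hz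
    obtain ⟨s, hs, rfl⟩ := hz
    rw [Finset.mem_powersetCard] at hs
    obtain ⟨hsA, hs2⟩ := hs
    obtain ⟨x, y, hxy, rfl⟩ := Finset.card_eq_two.mp hs2
    rw [Finset.sum_pair hxy, Finset.mem_compl]
    intro hmem
    obtain ⟨c, hc, hce⟩ := Finset.mem_image.mp hmem
    obtain ⟨a, ha, rfl⟩ := Finset.mem_image.mp (hsA (Finset.mem_insert_self x {y}))
    obtain ⟨b, hb, rfl⟩ := Finset.mem_image.mp
      (hsA (Finset.mem_insert_of_mem (Finset.mem_singleton_self y)))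
    apply h a ha b hb (fun e => hxy (by rw [e])) c hc
    rw [← ZMod.natCast_eq_zero_iff]
    push_cast
    rw [← hce]
    ring
  have hle : (hFoldRSum 2 A).card ≤ n - C.card := by
    have := Finset.card_le_card hsub
    rwa [Finset.card_compl, ZMod.card, hT] at this
  exact le_trans (Nat.sInf_le ⟨A, hA, rfl⟩) hle

lemma rhoHat_even_aux (h p : ℕ) (hh : 1 ≤ h) (hp : 1 ≤ p) :
    rhoHat (ZMod (2 * h * (2 * p + 1))) (h * (2 * p + 1) + 1) 2 ≤ 2 * h * (2 * p + 1) - 2 := by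
  let P : Finset (ℕ × ℕ) := (Finset.Ico 1 h ×ˢ Finset.range (2 * p + 1)) ∪
    (({0} ×ˢ Finset.range (p + 1)) ∪ ({h} ×ˢ Finset.Ico p (2 * p + 1)))
  have hP : ∀ x : ℕ × ℕ, x ∈ P → x.1 < 2 * h ∧ x.1 ≤ h ∧ x.2 < 2 * p + 1 ∧ (x.1 = 0 → x.2 ≤ p) ∧
      (x.1 = h → p ≤ x.2) := by
    rintro ⟨r, j⟩ hx
    simp only [P, Finset.mem_union, Finset.mem_product, Finset.mem_Ico, Finset.mem_range,
      Finset.mem_singleton] at hx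
    dsimp only
    omega
  have hPc : P.card = h * (2 * p + 1) + 1 := by
    rw [Finset.card_union_of_disjoint, Finset.card_union_of_disjoint]
    · simp only [Finset.card_product, Nat.card_Ico, Finset.card_range, Finset.card_singleton]
      obtain ⟨k, rfl⟩ : ∃ k, h = k + 1 := ⟨h - 1, by omega⟩
      have : 2 * p + 1 - p = p + 1 := by omega
      rw [this, Nat.add_sub_cancel]
      ring
    · rw [Finset.disjoint_left]
      rintro ⟨r, j⟩ hx
      simp only [Finset.mem_union, Finset.mem_product, Finset.mem_Ico, Finset.mem_range,
        Finset.mem_singleton] at hx ⊢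
      omega
    · rw [Finset.disjoint_left]
      rintro ⟨r, j⟩ hx
      simp only [Finset.mem_union, Finset.mem_product, Finset.mem_Ico, Finset.mem_range,
        Finset.mem_singleton] at hx ⊢
      omega
  let f : ℕ × ℕ → ℕ := fun x => x.1 + 2 * h * x.2
  have hC : ({0, 2 * h} : Finset ℕ).card = 2 := Finset.card_pair (by omega)
  have key := rhoHat_le_aux (2 * h * (2 * p + 1)) (h * (2 * p + 1) + 1) (by nlinarith)
    (P.image f) {0, 2 * h} ?_ ?_ ?_ ?_
  · rwa [hC] at key
  · intro x hx
    obtain ⟨⟨r, j⟩, hrj, rfl⟩ := Finset.mem_image.mp hx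
    obtain ⟨h1, -, h2, -⟩ := hP _ hrj
    dsimp only [f] at *
    have : j + 1 ≤ 2 * p + 1 := h2
    have := Nat.mul_le_mul_left (2 * h) this
    rw [Nat.mul_add, Nat.mul_one] at this
    omega
  · intro x hx
    have : 2 * h < 2 * h * (2 * p + 1) := by nlinarith
    simp only [Finset.mem_insert, Finset.mem_singleton] at hx
    omega
  · rw [← hPc]
    apply Finset.card_image_of_injOn
    rintro ⟨r, j⟩ hx ⟨r', j'⟩ hy hxy
    have h1 := (hP _ hx).1
    have h2 := (hP _ hy).1
    dsimp only [f] at *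
    have e1 : r = r' := by
      have := congrArg (· % (2 * h)) hxy
      simpa [Nat.add_mul_mod_self_left, Nat.mod_eq_of_lt h1, Nat.mod_eq_of_lt h2] using this
    subst e1
    have : 2 * h * j = 2 * h * j' := by omega
    have := Nat.eq_of_mul_eq_mul_left (by omega) this
    rw [this]
  · intro a ha b hb hab c hc hd
    obtain ⟨⟨r, j⟩, hx, rfl⟩ := Finset.mem_image.mp ha
    obtain ⟨⟨r', j'⟩, hy, rfl⟩ := Finset.mem_image.mp hb
    obtain ⟨h1, h2, h3, h4, h5⟩ := hP _ hx
    obtain ⟨g1, g2, g3, g4, g5⟩ := hP _ hy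
    obtain ⟨e, he, rfl⟩ : ∃ e ≤ 1, c = 2 * h * e := by
      simp only [Finset.mem_insert, Finset.mem_singleton] at hc
      rcases hc with rfl | rfl
      · exact ⟨0, by omega, by simp⟩
      · exact ⟨1, by omega, by simp⟩
    dsimp only [f] at *
    have e1 : r + 2 * h * j + (r' + 2 * h * j') + 2 * h * e = (r + r') + 2 * h * (j + j' + e) := by
      ring
    rw [e1] at hd
    have hd1 : 2 * h ∣ r + r' :=
      (Nat.dvd_add_left (Dvd.intro _ rfl)).mp (dvd_trans (Dvd.intro _ rfl) hd)
    obtain ⟨w, hw⟩ := hd1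
    have hw1 : w ≤ 1 := by
      by_contra hcon
      have : 2 * h * 2 ≤ 2 * h * w := Nat.mul_le_mul_left _ (by omega)
      have : r = h ∧ r' = h := by omega
      omega
    rw [hw, ← Nat.mul_add] at hd
    have hd2 := Nat.dvd_of_mul_dvd_mul_left (by omega) hd
    obtain ⟨v, hv⟩ := hd2
    interval_cases w
    · have r0 : r = 0 := by omega
      have r0' : r' = 0 := by omega
      have hj : j ≠ j' := by
        rintro rfl
        exact hab (by rw [r0, r0'])
      have := h4 r0
      have := g4 r0'
      rcases v with _ | v
      · omega
      · have : (2 * p + 1) * (v + 1) = (2 * p + 1) * v + (2 * p + 1) := by ring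
        omega
    · have r0 : r = h := by omega
      have r0' : r' = h := by omega
      have hj : j ≠ j' := by
        rintro rfl
        exact hab (by rw [r0, r0'])
      have := h5 r0
      have := g5 r0'
      rcases v with _ | _ | v
      · omega
      · omega
      · have : (2 * p + 1) * (v + 1 + 1) = (2 * p + 1) * v + 2 * (2 * p + 1) := by ring
        omega

theorem stmt19 (n : ℕ) (hn : 2 ≤ n) :
    ((∃ k : ℕ, n = 2 ^ k) → rhoHat (ZMod n) (n / 2 + 1) 2 ≤ n - 1) ∧
    (¬ (∃ k : ℕ, n = 2 ^ k) → rhoHat (ZMod n) (n / 2 + 1) 2 ≤ n - 2) := by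
  constructor
  · intro _
    have key := rhoHat_le_aux n (n / 2 + 1) hn (Finset.range (n / 2 + 1)) {0}
      (by intro x hx; rw [Finset.mem_range] at hx; omega)
      (by intro x hx; rw [Finset.mem_singleton] at hx; omega) (Finset.card_range _) ?_
    · simpa using key
    · intro a ha b hb hab c hc hd
      rw [Finset.mem_range] at ha hb
      rw [Finset.mem_singleton] at hc
      have := Nat.le_of_dvd (by omega) hd
      omega
  · intro hnp
    obtain ⟨k, q, hq, hnq⟩ := Nat.exists_eq_two_pow_mul_odd (n := n) (by omega)
    obtain ⟨p, rfl⟩ := hq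
    have hp : 1 ≤ p := by
      by_contra hcon
      have : p = 0 := by omega
      subst this
      exact hnp ⟨k, by simpa using hnq⟩
    rcases k with _ | k
    · have hC : ({0, 1} : Finset ℕ).card = 2 := rfl
      have key := rhoHat_le_aux n (n / 2 + 1) hn (Finset.range (n / 2 + 1)) {0, 1}
        (by intro x hx; rw [Finset.mem_range] at hx; omega)
        (by intro x hx; simp only [Finset.mem_insert, Finset.mem_singleton] at hx; omega)
        (Finset.card_range _) ?_
      · rwa [hC] at key
      · intro a ha b hb hab c hc hd
        rw [Finset.mem_range] at ha hb
        simp only [Finset.mem_insert, Finset.mem_singleton] at hc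
        rw [pow_zero, one_mul] at hnq
        have := Nat.le_of_dvd (by omega) hd
        omega
    · have key := rhoHat_even_aux (2 ^ k) p Nat.one_le_two_pow hp
      have hn' : n = 2 * 2 ^ k * (2 * p + 1) := by rw [hnq]; ring
      have hd : n / 2 = 2 ^ k * (2 * p + 1) := by
        rw [hn', mul_assoc]
        exact Nat.mul_div_cancel_left _ (by norm_num)
      rw [hd]
      subst hn'
      exact key
end
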